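/- Let A = ⊕_{i=1}^m M_{n_i}(k) be a finite direct sum of matrix algebras over an algebraically closed field k, viewed as an algebra over the Witt vectors O = W(k) via reduction. Then any O-algebra B, free of finite rank as an O-module, with B/pB ≅ A as k-algebras, is isomorphic to ⊕_i M_{n_i}(O) as an O-algebra. -/

import Mathlib

open WittVector

open scoped TensorProduct

section Adic

variable {O : Type*} [CommRing O] (I : Ideal O)

theorem Ideal.mul_mem_pow_smul_top {B : Type*} [Ring B] [Algebra O B] {a b : ℕ} {x y : B}
    (hx : x ∈ (I ^ a • ⊤ : Submodule O B)) (hy : y ∈ (I ^ b • ⊤ : Submodule O B)) :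
    x * y ∈ (I ^ (a + b) • ⊤ : Submodule O B) := by
  induction hx using Submodule.smul_induction_on' with
  | smul r hr z _ =>
    induction hy using Submodule.smul_induction_on' with
    | smul s hs w _ =>
      rw [smul_mul_smul_comm, pow_add]
      exact Submodule.smul_mem_smul (Ideal.mul_mem_mul hr hs) trivial
    | add w _ w' _ h h' => rw [mul_add]; exact add_mem h h'
  | add z _ z' _ h h' => rw [add_mul]; exact add_mem h h'

theorem Ideal.mul_mem_pow_smul_top_left {B : Type*} [Ring B] [Algebra O B] {a : ℕ} (x : B) {y : B}
    (hy : y ∈ (I ^ a • ⊤ : Submodule O B)) : x * y ∈ (I ^ a • ⊤ : Submodule O B) := by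
  have hx : x ∈ (I ^ 0 • ⊤ : Submodule O B) := by simp
  simpa using I.mul_mem_pow_smul_top hx hy

theorem Ideal.pow_smul_top_anti {B : Type*} [AddCommGroup B] [Module O B] {a b : ℕ} (h : a ≤ b) :
    (I ^ b • ⊤ : Submodule O B) ≤ I ^ a • ⊤ :=
  Submodule.smul_mono_left (Ideal.pow_le_pow_right h)

theorem IsPrecomplete.of_basis [IsPrecomplete I O] {B ι : Type*} [AddCommGroup B] [Module O B]
    [Fintype ι] (b : Module.Basis ι O B) : IsPrecomplete I B := by
  refine ⟨fun f hf => ?_⟩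
  have key (j : ι) : ∃ L, ∀ n, b.repr (f n) j ≡ L [SMOD (I ^ n • ⊤ : Submodule O O)] := by
    refine IsPrecomplete.prec ‹_› fun {m n} hmn => ?_
    have h := Submodule.mem_map_of_mem (f := b.coord j) (SModEq.sub_mem.1 (hf hmn))
    rw [Submodule.map_smul''] at h
    rw [SModEq.sub_mem]
    simpa using Submodule.smul_mono le_rfl le_top h
  choose L hL using key
  refine ⟨∑ j, L j • b j, fun n => ?_⟩
  rw [SModEq.sub_mem, ← b.sum_repr (f n), ← Finset.sum_sub_distrib]
  refine sum_mem fun j _ => ?_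
  rw [← sub_smul]
  refine Submodule.smul_mem_smul ?_ trivial
  simpa [SModEq.sub_mem] using hL j n

variable {M B : Type*} [Ring M] [Algebra O M] [Ring B] [Algebra O B]

/-- The failure of a linear map between algebras to be multiplicative. -/
def LinearMap.mulDefect (f : M →ₗ[O] B) : M →ₗ[O] M →ₗ[O] B :=
  (LinearMap.mul O M).compr₂ f - (LinearMap.mul O B).compl₁₂ f f

theorem LinearMap.mulDefect_apply (f : M →ₗ[O] B) (x y : M) :
    f.mulDefect x y = f (x * y) - f x * f y := rfl

variable {ι : Type*} [Fintype ι] {u v : ι → M}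

/-- Given a separability element `∑ u s ⊗ v s` of `M`, a linear map that is multiplicative
modulo `I ^ n` can be corrected to one that is multiplicative modulo `I ^ (n + 1)`. -/
theorem LinearMap.exists_mulDefect_mem_succ
    (hsep : ∀ x, ∑ s, u s ⊗ₜ[O] (v s * x) = ∑ s, (x * u s) ⊗ₜ[O] v s)
    (hone : ∑ s, u s * v s = 1) {n : ℕ} (hn : 1 ≤ n) (f : M →ₗ[O] B)
    (hf1 : 1 - f 1 ∈ (I ^ 1 • ⊤ : Submodule O B))
    (hf : ∀ x y, f.mulDefect x y ∈ (I ^ n • ⊤ : Submodule O B)) :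
    ∃ g : M →ₗ[O] B, 1 - g 1 ∈ (I ^ 1 • ⊤ : Submodule O B) ∧
      (∀ x y, g.mulDefect x y ∈ (I ^ (n + 1) • ⊤ : Submodule O B)) ∧
      ∀ x, f x - g x ∈ (I ^ n • ⊤ : Submodule O B) := by
  let h : M →ₗ[O] B := ∑ s, (LinearMap.mulLeft O (f (u s))) ∘ₗ f.mulDefect (v s)
  have h_apply (x : M) : h x = ∑ s, f (u s) * f.mulDefect (v s) x := by simp [h]
  have h_mem (x : M) : h x ∈ (I ^ n • ⊤ : Submodule O B) := by
    rw [h_apply]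
    exact sum_mem fun s _ => I.mul_mem_pow_smul_top_left _ (hf _ _)
  have h_sep (x y : M) : ∑ s, f (u s) * f.mulDefect (v s * x) y =
      ∑ s, f (x * u s) * f.mulDefect (v s) y := by
    simpa using congrArg (TensorProduct.lift
      ((LinearMap.mul O B).compl₁₂ f (f.mulDefect.flip y))) (hsep x)
  have h_one : ∑ s, f (u s) * f (v s) = f 1 - ∑ s, f.mulDefect (u s) (v s) := by
    rw [← hone, map_sum, ← Finset.sum_sub_distrib]
    simp [mulDefect_apply]
  have h_mul (x y : M) : h (x * y) = ∑ s, f (x * u s) * f.mulDefect (v s) y + h x * f y -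
      (∑ s, f (u s) * f (v s)) * f.mulDefect x y := by
    rw [← h_sep, h_apply, h_apply, Finset.sum_mul, Finset.sum_mul, ← Finset.sum_add_distrib,
      ← Finset.sum_sub_distrib]
    refine Finset.sum_congr rfl fun s _ => ?_
    simp only [mulDefect_apply, mul_assoc]
    noncomm_ring
  have h_defect (x y : M) : (f + h).mulDefect x y =
      ((1 - f 1) + ∑ s, f.mulDefect (u s) (v s)) * f.mulDefect x y +
        ∑ s, f.mulDefect x (u s) * f.mulDefect (v s) y - h x * h y := by
    have e : ∑ s, f.mulDefect x (u s) * f.mulDefect (v s) y =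
        ∑ s, f (x * u s) * f.mulDefect (v s) y - f x * h y := by
      rw [h_apply, Finset.mul_sum, ← Finset.sum_sub_distrib]
      refine Finset.sum_congr rfl fun s _ => ?_
      rw [mulDefect_apply f x, sub_mul, mul_assoc]
    rw [mulDefect_apply, add_apply, add_apply, add_apply, h_mul, e, h_one, mulDefect_apply f x y]
    noncomm_ring
  refine ⟨f + h, ?_, fun x y => ?_, fun x => ?_⟩
  · rw [add_apply, ← sub_sub]
    exact sub_mem hf1 (I.pow_smul_top_anti hn (h_mem 1))
  · rw [h_defect]
    have hnn : n + 1 ≤ n + n := by omega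
    refine sub_mem (add_mem ?_ (sum_mem fun s _ => ?_)) ?_
    · rw [add_comm n]
      exact I.mul_mem_pow_smul_top (add_mem hf1
        (sum_mem fun s _ => I.pow_smul_top_anti hn (hf _ _))) (hf _ _)
    · exact I.pow_smul_top_anti hnn (I.mul_mem_pow_smul_top (hf _ _) (hf _ _))
    · exact I.pow_smul_top_anti hnn (I.mul_mem_pow_smul_top (h_mem _) (h_mem _))
  · simpa using h_mem x

/-- A linear map from a separable algebra to an adically complete algebra which is an algebra
homomorphism modulo `I` is congruent modulo `I` to an algebra homomorphism. -/
theorem LinearMap.exists_algHom_sub_mem [IsAdicComplete I B]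
    (hsep : ∀ x, ∑ s, u s ⊗ₜ[O] (v s * x) = ∑ s, (x * u s) ⊗ₜ[O] v s)
    (hone : ∑ s, u s * v s = 1) (f : M →ₗ[O] B)
    (hf1 : 1 - f 1 ∈ (I ^ 1 • ⊤ : Submodule O B))
    (hf : ∀ x y, f.mulDefect x y ∈ (I ^ 1 • ⊤ : Submodule O B)) :
    ∃ g : M →ₐ[O] B, ∀ x, f x - g x ∈ (I ^ 1 • ⊤ : Submodule O B) := by
  let S (n : ℕ) := {f : M →ₗ[O] B // 1 - f 1 ∈ (I ^ 1 • ⊤ : Submodule O B) ∧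
    ∀ x y, f.mulDefect x y ∈ (I ^ (n + 1) • ⊤ : Submodule O B)}
  have step (n : ℕ) (f : S n) :
      ∃ g : S (n + 1), ∀ x, f.1 x - g.1 x ∈ (I ^ (n + 1) • ⊤ : Submodule O B) := by
    obtain ⟨g, h1, h2, h3⟩ := f.1.exists_mulDefect_mem_succ I hsep hone
      (Nat.le_add_left 1 n) f.2.1 f.2.2
    exact ⟨⟨g, h1, h2⟩, h3⟩
  choose next hnext using step
  let F (n : ℕ) : S n := Nat.rec ⟨f, hf1, hf⟩ next n
  have hF (m n : ℕ) (hmn : m ≤ n) (x : M) :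
      (F m).1 x - (F n).1 x ∈ (I ^ (m + 1) • ⊤ : Submodule O B) := by
    induction n, hmn using Nat.le_induction with
    | base => simp
    | succ n hmn ih =>
      rw [← sub_add_sub_cancel _ ((F n).1 x)]
      exact add_mem ih (I.pow_smul_top_anti (by omega) (hnext n (F n) x))
  have hlim (x : M) : ∃ L : B, ∀ n, (F n).1 x - L ∈ (I ^ n • ⊤ : Submodule O B) := by
    obtain ⟨L, hL⟩ := IsPrecomplete.prec (I := I) (M := B) inferInstance
      (f := fun n => (F n).1 x) fun {m n} hmn =>
        SModEq.sub_mem.2 (I.pow_smul_top_anti (Nat.le_succ m) (hF m n hmn x))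
    exact ⟨L, fun n => SModEq.sub_mem.1 (hL n)⟩
  choose L hL using hlim
  have hzero {z : B} (hz : ∀ n, z ∈ (I ^ n • ⊤ : Submodule O B)) : z = 0 :=
    IsHausdorff.haus (I := I) inferInstance z fun n => SModEq.zero.2 (hz n)
  have hadd (x y : M) : L (x + y) = L x + L y := by
    refine sub_eq_zero.1 (hzero fun n => ?_)
    convert sub_mem (add_mem (hL x n) (hL y n)) (hL (x + y) n) using 1
    rw [map_add]; abel
  have hsmul (r : O) (x : M) : L (r • x) = r • L x := by
    refine sub_eq_zero.1 (hzero fun n => ?_)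
    convert sub_mem (Submodule.smul_mem _ r (hL x n)) (hL (r • x) n) using 1
    rw [map_smul, smul_sub]; abel
  have hmul_right {n : ℕ} {x : B} (hx : x ∈ (I ^ n • ⊤ : Submodule O B)) (y : B) :
      x * y ∈ (I ^ n • ⊤ : Submodule O B) := by
    simpa using I.mul_mem_pow_smul_top (b := 0) hx (y := y) (by simp)
  have hmul (x y : M) : L (x * y) = L x * L y := by
    refine sub_eq_zero.1 (hzero fun n => ?_)
    have h1 := I.pow_smul_top_anti (Nat.le_succ n) ((F n).2.2 x y)
    rw [mulDefect_apply] at h1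
    convert add_mem (sub_mem h1 (hL (x * y) n)) (add_mem (hmul_right (hL x n) ((F n).1 y))
      (I.mul_mem_pow_smul_top_left (L x) (hL y n))) using 1
    noncomm_ring
  have hL0 (x : M) : f x - L x ∈ (I ^ 1 • ⊤ : Submodule O B) := by
    rw [← sub_add_sub_cancel _ ((F 1).1 x)]
    exact add_mem (hF 0 1 zero_le_one x) (hL x 1)
  have hL1 : L 1 = 1 := by
    have hidem : IsIdempotentElem (1 - L 1) :=
      IsIdempotentElem.one_sub (by rw [IsIdempotentElem, ← hmul, mul_one])
    have hmem : 1 - L 1 ∈ (I ^ 1 • ⊤ : Submodule O B) := by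
      rw [← sub_add_sub_cancel _ (f 1)]
      exact add_mem hf1 (hL0 1)
    refine (sub_eq_zero.1 (hzero fun n => ?_)).symm
    induction n with
    | zero => simp
    | succ n ih =>
      rw [← hidem.eq]
      exact I.mul_mem_pow_smul_top ih hmem
  exact ⟨AlgHom.ofLinearMap ⟨⟨L, hadd⟩, hsmul⟩ hL1 hmul, hL0⟩

end Adic

section PiMatrix

variable {O κ : Type*} [CommRing O] [DecidableEq κ] {n : κ → ℕ}

/-- The matrix unit `E_{ab}` in the `i`-th factor of a product of matrix algebras. -/
def Matrix.piSingle (R : Type*) [CommRing R] (i : κ) (a b : Fin (n i)) :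
    (i : κ) → Matrix (Fin (n i)) (Fin (n i)) R :=
  Pi.single i (Matrix.single a b 1)

theorem Matrix.piSingle_mul_same (i : κ) (a b c d : Fin (n i)) :
    piSingle O i a b * piSingle O i c d = if b = c then piSingle O i a d else 0 := by
  rw [piSingle, piSingle, ← Pi.single_mul]
  split_ifs with h
  · subst h; simp [piSingle]
  · simp [h]

theorem Matrix.piSingle_mul_of_ne {i j : κ} (h : i ≠ j) (a b : Fin (n i)) (c d : Fin (n j)) :
    piSingle O i a b * piSingle O j c d = 0 := by
  ext l
  rcases eq_or_ne l i with rfl | hl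
  · simp [piSingle, h]
  · simp [piSingle, hl]

variable [Fintype κ]

theorem Matrix.eq_sum_piSingle (x : (i : κ) → Matrix (Fin (n i)) (Fin (n i)) O) :
    x = ∑ i, ∑ a, ∑ b, x i a b • piSingle O i a b := by
  have (i : κ) (a b : Fin (n i)) :
      x i a b • piSingle O i a b = Pi.single i (Matrix.single a b (x i a b)) := by
    rw [piSingle, ← Pi.single_smul, smul_single, smul_eq_mul, mul_one]
  simp_rw [this]
  conv_lhs => rw [← Finset.univ_sum_single x]
  refine Finset.sum_congr rfl fun i _ => ?_
  conv_lhs => rw [matrix_eq_sum_single (x i)]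
  change AddMonoidHom.single (fun i => Matrix (Fin (n i)) (Fin (n i)) O) i _ = _
  simp_rw [map_sum]
  rfl

theorem Matrix.sum_piSingle_tmul
    (x : (i : κ) → Matrix (Fin (n i)) (Fin (n i)) O) :
    ∑ s : (i : κ) × Fin (n i),
      piSingle O s.1 s.2 ⟨0, s.2.pos⟩ ⊗ₜ[O] (piSingle O s.1 ⟨0, s.2.pos⟩ s.2 * x) =
    ∑ s : (i : κ) × Fin (n i),
      (x * piSingle O s.1 s.2 ⟨0, s.2.pos⟩) ⊗ₜ[O] piSingle O s.1 ⟨0, s.2.pos⟩ s.2 := by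
  rw [eq_sum_piSingle x]
  simp only [Finset.mul_sum, Finset.sum_mul, TensorProduct.tmul_sum, TensorProduct.sum_tmul,
    mul_smul_comm, smul_mul_assoc, TensorProduct.tmul_smul, ← TensorProduct.smul_tmul']
  rw [Finset.sum_comm]
  conv_rhs => rw [Finset.sum_comm]
  refine Finset.sum_congr rfl fun i _ => ?_
  rw [Finset.sum_comm]
  conv_rhs => rw [Finset.sum_comm]
  refine Finset.sum_congr rfl fun a _ => ?_
  rw [Finset.sum_comm]
  conv_rhs => rw [Finset.sum_comm]
  refine Finset.sum_congr rfl fun b _ => ?_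
  rw [← Finset.smul_sum, ← Finset.smul_sum]
  congr 1
  rw [Finset.sum_eq_single (⟨i, a⟩ : (i : κ) × Fin (n i)),
    Finset.sum_eq_single (⟨i, b⟩ : (i : κ) × Fin (n i))]
  · simp [piSingle_mul_same]
  · rintro ⟨j, c⟩ - h
    rcases eq_or_ne i j with rfl | hij
    · rw [piSingle_mul_same, if_neg (by rintro rfl; exact h rfl), TensorProduct.zero_tmul]
    · rw [piSingle_mul_of_ne hij, TensorProduct.zero_tmul]
  · simp
  · rintro ⟨j, c⟩ - h
    rcases eq_or_ne j i with rfl | hij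
    · rw [piSingle_mul_same, if_neg (by rintro rfl; exact h rfl), TensorProduct.tmul_zero]
    · rw [piSingle_mul_of_ne hij, TensorProduct.tmul_zero]
  · simp

theorem Matrix.sum_piSingle_mul :
    ∑ s : (i : κ) × Fin (n i),
      piSingle O s.1 s.2 ⟨0, s.2.pos⟩ * piSingle O s.1 ⟨0, s.2.pos⟩ s.2 = 1 := by
  conv_rhs => rw [eq_sum_piSingle (1 : (i : κ) → Matrix (Fin (n i)) (Fin (n i)) O)]
  simp [piSingle_mul_same, Fintype.sum_sigma, Matrix.one_apply]

end PiMatrix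
/-- A homomorphism from a commutative ring to a matrix ring with central image takes values in
scalar matrices. -/
theorem Matrix.exists_ringHom_eq_scalar {S k ν : Type*} [CommRing S] [CommRing k] [Fintype ν]
    [DecidableEq ν] [Nonempty ν] (ψ : S →+* Matrix ν ν k) (hψ : ∀ c x, Commute x (ψ c)) :
    ∃ ρ : S →+* k, ∀ c, ψ c = Matrix.scalar ν (ρ c) := by
  have h (c : S) : ∃ r, Matrix.scalar ν r = ψ c :=
    Matrix.mem_range_scalar_iff_commute_single'.2 fun _ _ => hψ c _
  choose ρ hρ using h
  have hinj : Function.Injective (Matrix.scalar ν (α := k)) := fun _ _ => Matrix.scalar_inj.1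
  refine ⟨⟨⟨⟨ρ, hinj ?_⟩, fun x y => hinj ?_⟩, hinj ?_, fun x y => hinj ?_⟩, fun c => (hρ c).symm⟩
  all_goals simp only [hρ, map_one, map_mul, map_zero, map_add]

section Witt

variable {p : ℕ} [Fact p.Prime] {k : Type*} [Field k] [CharP k p]

theorem WittVector.ker_eq_span_p_of_surjective [PerfectRing k p] (ρ : WittVector p k →+* k)
    (hρ : Function.Surjective ρ) : RingHom.ker ρ = Ideal.span {(p : WittVector p k)} := by
  have := RingHom.ker_isMaximal_of_surjective ρ hρ
  rw [IsLocalRing.eq_maximalIdeal this, (WittVector.irreducible p).maximalIdeal_eq]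

theorem WittVector.surjective_of_isIntegral [IsAlgClosed k] (ρ : WittVector p k →+* k)
    (hρ : ρ.IsIntegral) :
    Function.Surjective ρ := by
  have hker : RingHom.ker (constantCoeff : WittVector p k →+* k) ≤ RingHom.ker ρ := by
    rw [ker_constantCoeff, Ideal.span_singleton_le_iff_mem, RingHom.mem_ker, map_natCast,
      CharP.cast_eq_zero]
  let σ : k →+* k := RingHom.liftOfSurjective constantCoeff (constantCoeff_surjective p) ⟨ρ, hker⟩
  have hσ : σ.comp constantCoeff = ρ :=
    RingHom.liftOfRightInverse_comp _ _ _ ⟨ρ, hker⟩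
  have hint : σ.IsIntegral := RingHom.IsIntegral.tower_top constantCoeff σ (hσ ▸ hρ)
  rw [← hσ]
  exact (IsAlgClosed.ringHom_bijective_of_isIntegral σ hint).2.comp (constantCoeff_surjective p)

/-- The structure map of a finite `WittVector p k`-algebra becomes, in a matrix algebra quotient, a
surjection from `WittVector p k` onto the scalar matrices. -/
theorem WittVector.exists_surjective_eq_scalar [IsAlgClosed k] {d : ℕ} {B : Type*} [Ring B]
    [Algebra (WittVector p k) B] [Module.Finite (WittVector p k) B]
    (ψ : B →+* Matrix (Fin d) (Fin d) k)
    (hψ : Function.Surjective ψ) :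
    ∃ ρ : WittVector p k →+* k, Function.Surjective ρ ∧
      ∀ c, ψ (algebraMap (WittVector p k) B c) = Matrix.scalar (Fin d) (ρ c) := by
  rcases isEmpty_or_nonempty (Fin d) with hd | hd
  · exact ⟨constantCoeff, constantCoeff_surjective p, fun c => Subsingleton.elim _ _⟩
  obtain ⟨ρ, hρ⟩ := Matrix.exists_ringHom_eq_scalar
    (ψ.comp (algebraMap (WittVector p k) B)) fun c x => by
      obtain ⟨b, rfl⟩ := hψ x
      exact (Algebra.commute_algebraMap_right c b).map ψ
  refine ⟨ρ, surjective_of_isIntegral ρ fun y => ?_, hρ⟩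
  obtain ⟨b, hb⟩ := hψ (Matrix.scalar (Fin d) y)
  obtain ⟨q, hq, hqb⟩ := Algebra.IsIntegral.isIntegral (R := WittVector p k) b
  refine ⟨q, hq, (Matrix.scalar_inj (n := Fin d)).1 ?_⟩
  have hcomp : (Matrix.scalar (Fin d)).comp ρ = ψ.comp (algebraMap (WittVector p k) B) :=
    RingHom.ext fun c => (hρ c).symm
  rw [Polynomial.hom_eval₂, hcomp, ← hb, ← Polynomial.hom_eval₂, hqb, map_zero, map_zero]

end Witt

/-- Rigidity of lifts of semisimple algebras: let `k` be an algebraically closed field of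
characteristic `p`, `O = W(k)` its ring of Witt vectors, and `A = ⊕_{i} M_{n_i}(k)`.
Any `O`-algebra `B`, free of finite rank as an `O`-module, with `B/pB ≅ A` (expressed by
a surjective ring homomorphism `B → A` with kernel `pB`), is isomorphic to
`⊕_i M_{n_i}(O)` as an `O`-algebra. -/
theorem statement14 (p : ℕ) [Fact p.Prime] (k : Type) [Field k] [IsAlgClosed k] [CharP k p]
    (m : ℕ) (n : Fin m → ℕ)
    (B : Type) [Ring B] [Algebra (WittVector p k) B]
    [Module.Free (WittVector p k) B] [Module.Finite (WittVector p k) B]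
    (φ : B →+* ((i : Fin m) → Matrix (Fin (n i)) (Fin (n i)) k))
    (hsurj : Function.Surjective φ)
    (hker : RingHom.ker φ = Ideal.span {((p : ℕ) : B)}) :
    Nonempty (B ≃ₐ[WittVector p k]
      ((i : Fin m) → Matrix (Fin (n i)) (Fin (n i)) (WittVector p k))) := by
  let I : Ideal (WittVector p k) := Ideal.span {(p : WittVector p k)}
  have hIjac : I ≤ Ideal.jacobson ⊥ := IsAdicComplete.le_jacobson_bot I
  have : IsAdicComplete I B :=
    { toIsHausdorff := IsHausdorff.of_le_jacobson I B hIjac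
      toIsPrecomplete := IsPrecomplete.of_basis I (Module.Free.chooseBasis (WittVector p k) B) }
  have hφ (x : B) : x ∈ (I ^ 1 • ⊤ : Submodule (WittVector p k) B) ↔ φ x = 0 := by
    rw [← RingHom.mem_ker, hker, Ideal.mem_span_singleton', pow_one,
      Submodule.ideal_span_singleton_smul, Submodule.mem_smul_pointwise_iff_exists]
    simp [Algebra.smul_def, Nat.cast_comm]
  have hρ (i : Fin m) := WittVector.exists_surjective_eq_scalar ((Pi.evalRingHom _ i).comp φ)
    ((Function.surjective_eval i).comp hsurj)
  choose ρ hρ_surj hρ using hρ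
  let g : ((i : Fin m) → Matrix (Fin (n i)) (Fin (n i)) (WittVector p k)) →+*
      ((i : Fin m) → Matrix (Fin (n i)) (Fin (n i)) k) :=
    RingHom.pi fun i => (ρ i).mapMatrix.comp (Pi.evalRingHom _ i)
  have hg_apply (x i) : g x i = (ρ i).mapMatrix (x i) := rfl
  have hg_surj : Function.Surjective g := fun y => by
    choose x hx using fun i a b => hρ_surj i (y i a b)
    exact ⟨fun i => Matrix.of (x i), by ext i a b; exact hx i a b⟩
  have hg_single (i : Fin m) (a b : Fin (n i)) :
      g (Matrix.piSingle (WittVector p k) i a b) = Matrix.piSingle k i a b := by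
    ext1 j
    rcases eq_or_ne j i with rfl | hj
    · simp [hg_apply, Matrix.piSingle]
    · simp [hg_apply, Matrix.piSingle, hj]
  have hg_smul (c : WittVector p k) (x : B)
      (y : (i : Fin m) → Matrix (Fin (n i)) (Fin (n i)) (WittVector p k))
      (h : φ x = g y) : φ (c • x) = g (c • y) := by
    rw [Algebra.smul_def, Algebra.smul_def, map_mul, map_mul, h]
    congr 1
    ext1 i
    refine (hρ i c).trans ?_
    rw [hg_apply, Pi.algebraMap_apply, Matrix.algebraMap_eq_diagonal, RingHom.mapMatrix_apply,
      Matrix.diagonal_map (map_zero _)]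
    rfl
  choose lift hlift using fun i (a b : Fin (n i)) => hsurj (Matrix.piSingle k i a b)
  let f₀ : ((i : Fin m) → Matrix (Fin (n i)) (Fin (n i)) (WittVector p k)) →ₗ[WittVector p k] B :=
    ∑ i, ∑ a, ∑ b, (Matrix.entryLinearMap (WittVector p k) (WittVector p k) a b ∘ₗ
      LinearMap.proj i).smulRight (lift i a b)
  have hf₀ (x) : φ (f₀ x) = g x := by
    conv_rhs => rw [Matrix.eq_sum_piSingle x]
    simp only [f₀, LinearMap.sum_apply, map_sum]
    refine Finset.sum_congr rfl fun i _ => Finset.sum_congr rfl fun a _ =>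
      Finset.sum_congr rfl fun b _ => hg_smul _ _ _ ?_
    rw [hlift, hg_single]
  obtain ⟨f, hf⟩ := f₀.exists_algHom_sub_mem I Matrix.sum_piSingle_tmul Matrix.sum_piSingle_mul
    ((hφ _).2 (by rw [map_sub, hf₀, map_one, map_one, sub_self]))
    fun x y => (hφ _).2 (by
      rw [LinearMap.mulDefect_apply, map_sub, map_mul φ, hf₀, hf₀, hf₀, map_mul, sub_self])
  have hφf (x) : φ (f x) = g x := by
    rw [← hf₀, eq_comm, ← sub_eq_zero, ← map_sub]
    exact (hφ _).1 (hf x)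
  have hf_surj : Function.Surjective f := by
    have h : (⊤ : Submodule (WittVector p k) B) ≤ LinearMap.range f.toLinearMap := by
      refine Submodule.le_of_le_smul_of_le_jacobson_bot Module.Finite.fg_top hIjac fun b _ => ?_
      obtain ⟨x, hx⟩ := hg_surj (φ b)
      rw [← add_sub_cancel (f x) b]
      refine Submodule.add_mem_sup ⟨x, rfl⟩ ?_
      rw [← pow_one I, hφ, map_sub, hφf, hx, sub_self]
    exact fun b => h trivial
  have hf_inj : Function.Injective f := by
    have h : LinearMap.ker f.toLinearMap = ⊥ := by
      refine Submodule.eq_bot_of_le_smul_of_le_jacobson_bot I _ (IsNoetherian.noetherian _)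
        (fun x hx => ?_) hIjac
      have hx0 : f x = 0 := hx
      have hgx : g x = 0 := by rw [← hφf, hx0, map_zero]
      have hdvd (i : Fin m) (a b : Fin (n i)) : ∃ y : WittVector p k, y * p = x i a b := by
        rw [← Ideal.mem_span_singleton', ← WittVector.ker_eq_span_p_of_surjective _ (hρ_surj i)]
        exact congrFun (congrFun (congrFun hgx i) a) b
      choose y hy using hdvd
      let y' : (i : Fin m) → Matrix (Fin (n i)) (Fin (n i)) (WittVector p k) :=
        fun i => Matrix.of (y i)
      have hxy : (p : WittVector p k) • y' = x := by
        ext1 i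
        ext1 a b
        rw [← hy, mul_comm]
        rfl
      rw [← hxy, map_smul] at hx0
      rw [← hxy]
      refine Submodule.smul_mem_smul (Ideal.mem_span_singleton_self _) ?_
      exact (smul_eq_zero.1 hx0).resolve_left (WittVector.irreducible p).ne_zero
    exact LinearMap.ker_eq_bot.1 h
  exact ⟨(AlgEquiv.ofBijective f ⟨hf_inj, hf_surj⟩).symm⟩
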